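/- arXiv:1602.08367 — 11 statements merged into one kernel-verified Lean document; each statement's English description precedes it below -/
import Mathlib

section
/- Let e₁,…,e₆ be the standard basis of ℝ⁶ and let J ∈ M₆(ℝ) be defined by Je₁=e₂, Je₂=−e₁, Je₃=e₄, Je₄=−e₃, Je₅=e₆, Je₆=−e₅. For any A ∈ M₆(ℝ) the following are equivalent: (i) θ(A)ρ⁺ = 0; (ii) θ(A)ρ⁻ = 0; (iii) AJ = JA, tr(A) = 0 and tr(AJ) = 0. -/
open Matrix

/-- The complex structure `J` on `ℝ⁶`: `Je₁ = e₂`, `Je₂ = -e₁`, `Je₃ = e₄`, `Je₄ = -e₃`,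
`Je₅ = e₆`, `Je₆ = -e₅`. -/
noncomputable def J6 : Matrix (Fin 6) (Fin 6) ℝ :=
  !![0,-1,0,0,0,0; 1,0,0,0,0,0; 0,0,0,-1,0,0; 0,0,1,0,0,0; 0,0,0,0,0,-1; 0,0,0,0,1,0]

/-- The action `θ(A)` of a matrix on a bilinear (2-)form:
`(θ(A)γ)(x,y) = -(γ(Ax,y) + γ(x,Ay))`. -/
noncomputable def theta2 {n : ℕ} (A : Matrix (Fin n) (Fin n) ℝ)
    (γ : (Fin n → ℝ) → (Fin n → ℝ) → ℝ) : (Fin n → ℝ) → (Fin n → ℝ) → ℝ :=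
  fun x y => -(γ (A.mulVec x) y + γ x (A.mulVec y))

/-- The action `θ(A)` of a matrix on a trilinear (3-)form:
`(θ(A)γ)(x,y,z) = -(γ(Ax,y,z) + γ(x,Ay,z) + γ(x,y,Az))`. -/
noncomputable def theta3 {n : ℕ} (A : Matrix (Fin n) (Fin n) ℝ)
    (γ : (Fin n → ℝ) → (Fin n → ℝ) → (Fin n → ℝ) → ℝ) :
    (Fin n → ℝ) → (Fin n → ℝ) → (Fin n → ℝ) → ℝ :=
  fun x y z => -(γ (A.mulVec x) y z + γ x (A.mulVec y) z + γ x y (A.mulVec z))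

/-- The elementary alternating 3-form `eⁱ ∧ eʲ ∧ eᵏ` on `ℝⁿ`. -/
noncomputable def w3 {n : ℕ} (i j k : Fin n) (x y z : Fin n → ℝ) : ℝ :=
  Matrix.det !![x i, x j, x k; y i, y j, y k; z i, z j, z k]

/-- `ρ⁺ = e¹∧e³∧e⁵ − e¹∧e⁴∧e⁶ − e²∧e³∧e⁶ − e²∧e⁴∧e⁵` on `ℝ⁶`. -/
noncomputable def rhoPlus : (Fin 6 → ℝ) → (Fin 6 → ℝ) → (Fin 6 → ℝ) → ℝ :=
  fun x y z => w3 0 2 4 x y z - w3 0 3 5 x y z - w3 1 2 5 x y z - w3 1 3 4 x y z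

/-- `ρ⁻ = −e²∧e⁴∧e⁶ + e²∧e³∧e⁵ + e¹∧e⁴∧e⁵ + e¹∧e³∧e⁶` on `ℝ⁶`. -/
noncomputable def rhoMinus : (Fin 6 → ℝ) → (Fin 6 → ℝ) → (Fin 6 → ℝ) → ℝ :=
  fun x y z => -(w3 1 3 5 x y z) + w3 1 2 4 x y z + w3 0 3 4 x y z + w3 0 2 5 x y z

/-- The 2-form `ω(x,y) = ⟨Jx, y⟩` on `ℝ⁶`. -/
noncomputable def omega6 : (Fin 6 → ℝ) → (Fin 6 → ℝ) → ℝ :=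
  fun x y => (J6.mulVec x) ⬝ᵥ y

/-- The positive 3-form
`φ = e¹²⁷ + e³⁴⁷ + e⁵⁶⁷ + e¹³⁵ − e¹⁴⁶ − e²³⁶ − e²⁴⁵` on `ℝ⁷`. -/
noncomputable def phi7 : (Fin 7 → ℝ) → (Fin 7 → ℝ) → (Fin 7 → ℝ) → ℝ :=
  fun x y z => w3 0 1 6 x y z + w3 2 3 6 x y z + w3 4 5 6 x y z
    + w3 0 2 4 x y z - w3 0 3 5 x y z - w3 1 2 5 x y z - w3 1 3 4 x y z

/-- The block diagonal matrix `diag(M, q) ∈ M₇(ℝ)` for `M ∈ M₆(ℝ)`, `q ∈ ℝ`. -/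
noncomputable def blockDiag7 (M : Matrix (Fin 6) (Fin 6) ℝ) (q : ℝ) :
    Matrix (Fin 7) (Fin 7) ℝ :=
  Matrix.of fun i j =>
    if hi : (i : ℕ) < 6 then
      if hj : (j : ℕ) < 6 then M ⟨i, hi⟩ ⟨j, hj⟩ else 0
    else if (j : ℕ) < 6 then 0 else q

/-- The projection `π : ℝ⁷ → ℝ⁶` onto the first six coordinates. -/
noncomputable def proj76 (x : Fin 7 → ℝ) : Fin 6 → ℝ := fun i => x i.castSucc

/-- Condition (iii) in terms of matrix entries. -/
theorem cond_iff (A : Matrix (Fin 6) (Fin 6) ℝ) :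
    (A * J6 = J6 * A ∧ A.trace = 0 ∧ (A * J6).trace = 0) ↔
    (A 1 1 = A 0 0 ∧
    A 0 1 = -A 1 0 ∧
    A 1 3 = A 0 2 ∧
    A 0 3 = -A 1 2 ∧
    A 1 5 = A 0 4 ∧
    A 0 5 = -A 1 4 ∧
    A 3 1 = A 2 0 ∧
    A 2 1 = -A 3 0 ∧
    A 3 3 = A 2 2 ∧
    A 2 3 = -A 3 2 ∧
    A 3 5 = A 2 4 ∧
    A 2 5 = -A 3 4 ∧
    A 5 1 = A 4 0 ∧
    A 4 1 = -A 5 0 ∧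
    A 5 3 = A 4 2 ∧
    A 4 3 = -A 5 2 ∧
    A 5 5 = A 4 4 ∧
    A 4 5 = -A 5 4 ∧
    A 4 4 = -A 0 0 - A 2 2 ∧
    A 5 4 = -A 1 0 - A 3 2) := by
  constructor
  · rintro ⟨h, h1, h2⟩
    have g : ∀ i j, (A * J6) i j = (J6 * A) i j := fun i j => by rw [h]
    clear h
    simp [Matrix.trace, Fin.sum_univ_six, Matrix.mul_apply, J6, Fin.forall_fin_succ] at g h1 h2
    grind
  · intro h
    refine ⟨?_, ?_, ?_⟩
    · ext i j
      fin_cases i <;> fin_cases j <;> simp [Fin.sum_univ_six, Matrix.mul_apply, J6] <;> linarith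
    · simp [Matrix.trace, Fin.sum_univ_six]; linarith
    · simp [Matrix.trace, Fin.sum_univ_six, Matrix.mul_apply, J6]; linarith

theorem fwd_plus (A : Matrix (Fin 6) (Fin 6) ℝ) (h : ∀ x y z, theta3 A rhoPlus x y z = 0) :
    A * J6 = J6 * A ∧ A.trace = 0 ∧ (A * J6).trace = 0 := by
  rw [cond_iff]
  have g : ∀ i j k : Fin 6, theta3 A rhoPlus (Pi.single i 1) (Pi.single j 1) (Pi.single k 1) = 0 :=
    fun i j k => h _ _ _
  simp only [theta3, rhoPlus, w3, det_fin_three, mulVec_single_one] at g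
  have h012 := g 0 1 2
  have h013 := g 0 1 3
  have h014 := g 0 1 4
  have h015 := g 0 1 5
  have h023 := g 0 2 3
  have h024 := g 0 2 4
  have h025 := g 0 2 5
  have h034 := g 0 3 4
  have h035 := g 0 3 5
  have h045 := g 0 4 5
  have h123 := g 1 2 3
  have h124 := g 1 2 4
  have h125 := g 1 2 5
  have h134 := g 1 3 4
  have h135 := g 1 3 5
  have h145 := g 1 4 5
  have h234 := g 2 3 4
  have h235 := g 2 3 5
  have h245 := g 2 4 5
  have h345 := g 3 4 5
  clear h g
  simp [Pi.single_apply] at h012 h013 h014 h015 h023 h024 h025 h034 h035 h045 h123 h124 h125 h134 h135 h145 h234 h235 h245 h345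
  refine ⟨?_, ?_, ?_, ?_, ?_, ?_, ?_, ?_, ?_, ?_, ?_, ?_, ?_, ?_, ?_, ?_, ?_, ?_, ?_, ?_⟩ <;> linarith

theorem fwd_minus (A : Matrix (Fin 6) (Fin 6) ℝ) (h : ∀ x y z, theta3 A rhoMinus x y z = 0) :
    A * J6 = J6 * A ∧ A.trace = 0 ∧ (A * J6).trace = 0 := by
  rw [cond_iff]
  have g : ∀ i j k : Fin 6, theta3 A rhoMinus (Pi.single i 1) (Pi.single j 1) (Pi.single k 1) = 0 :=
    fun i j k => h _ _ _
  simp only [theta3, rhoMinus, w3, det_fin_three, mulVec_single_one] at g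
  have h012 := g 0 1 2
  have h013 := g 0 1 3
  have h014 := g 0 1 4
  have h015 := g 0 1 5
  have h023 := g 0 2 3
  have h024 := g 0 2 4
  have h025 := g 0 2 5
  have h034 := g 0 3 4
  have h035 := g 0 3 5
  have h045 := g 0 4 5
  have h123 := g 1 2 3
  have h124 := g 1 2 4
  have h125 := g 1 2 5
  have h134 := g 1 3 4
  have h135 := g 1 3 5
  have h145 := g 1 4 5
  have h234 := g 2 3 4
  have h235 := g 2 3 5
  have h245 := g 2 4 5
  have h345 := g 3 4 5
  clear h g
  simp [Pi.single_apply] at h012 h013 h014 h015 h023 h024 h025 h034 h035 h045 h123 h124 h125 h134 h135 h145 h234 h235 h245 h345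
  refine ⟨?_, ?_, ?_, ?_, ?_, ?_, ?_, ?_, ?_, ?_, ?_, ?_, ?_, ?_, ?_, ?_, ?_, ?_, ?_, ?_⟩ <;> linarith

theorem bwd_plus (A : Matrix (Fin 6) (Fin 6) ℝ)
    (h : A * J6 = J6 * A ∧ A.trace = 0 ∧ (A * J6).trace = 0) (x y z : Fin 6 → ℝ) :
    theta3 A rhoPlus x y z = 0 := by
  rw [cond_iff] at h
  obtain ⟨c0, c1, c2, c3, c4, c5, c6, c7, c8, c9, c10, c11, c12, c13, c14, c15, c16, c17, c18, c19⟩ := h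
  simp only [theta3, rhoPlus, w3, det_fin_three, mulVec, dotProduct, Fin.sum_univ_six, Matrix.of_apply, Matrix.cons_val]
  simp only [c0, c1, c2, c3, c4, c5, c6, c7, c8, c9, c10, c11, c12, c13, c14, c15, c16, c17, c18, c19]
  ring

theorem bwd_minus (A : Matrix (Fin 6) (Fin 6) ℝ)
    (h : A * J6 = J6 * A ∧ A.trace = 0 ∧ (A * J6).trace = 0) (x y z : Fin 6 → ℝ) :
    theta3 A rhoMinus x y z = 0 := by
  rw [cond_iff] at h
  obtain ⟨c0, c1, c2, c3, c4, c5, c6, c7, c8, c9, c10, c11, c12, c13, c14, c15, c16, c17, c18, c19⟩ := h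
  simp only [theta3, rhoMinus, w3, det_fin_three, mulVec, dotProduct, Fin.sum_univ_six, Matrix.of_apply, Matrix.cons_val]
  simp only [c0, c1, c2, c3, c4, c5, c6, c7, c8, c9, c10, c11, c12, c13, c14, c15, c16, c17, c18, c19]
  ring

/-- For `A ∈ M₆(ℝ)` the following are equivalent: (i) `θ(A)ρ⁺ = 0`; (ii) `θ(A)ρ⁻ = 0`;
(iii) `AJ = JA`, `tr A = 0` and `tr (AJ) = 0` (i.e. `A ∈ sl(3,ℂ)`). -/
theorem stmt2 (A : Matrix (Fin 6) (Fin 6) ℝ) :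
    ((∀ x y z, theta3 A rhoPlus x y z = 0) ↔ (∀ x y z, theta3 A rhoMinus x y z = 0)) ∧
    ((∀ x y z, theta3 A rhoPlus x y z = 0) ↔
      (A * J6 = J6 * A ∧ A.trace = 0 ∧ (A * J6).trace = 0)) := by
  exact ⟨⟨fun h => bwd_minus A (fwd_plus A h), fun h => bwd_plus A (fwd_minus A h)⟩,
    fun h => fwd_plus A h, fun h => bwd_plus A h⟩
end

section
/- Let e₁,…,e₆ be the standard basis of ℝ⁶, J ∈ M₆(ℝ) defined by Je₁=e₂, Je₂=−e₁, Je₃=e₄, Je₄=−e₃, Je₅=e₆, Je₆=−e₅, and ω the alternating 2-form on ℝ⁶ with ω(x,y) = ⟨Jx,y⟩. If A ∈ M₆(ℝ) satisfies AJ = JA, then for all x, y ∈ ℝ⁶, (θ(A)(θ(Aᵀ)ω))(x,y) = ⟨J((A+Aᵀ)² − [A,Aᵀ])x, y⟩, where [A,Aᵀ] := AAᵀ − AᵀA. -/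
open Matrix

/-- If `A ∈ M₆(ℝ)` commutes with `J`, then
`(θ(A)(θ(Aᵀ)ω))(x,y) = ⟨J((A+Aᵀ)² − [A,Aᵀ])x, y⟩` for all `x, y ∈ ℝ⁶`,
where `[A,Aᵀ] = AAᵀ − AᵀA`. -/
theorem stmt5 (A : Matrix (Fin 6) (Fin 6) ℝ) (hA : A * J6 = J6 * A) :
    ∀ x y : Fin 6 → ℝ,
      theta2 A (theta2 Aᵀ omega6) x y =
        ((J6 * ((A + Aᵀ)^2 - (A * Aᵀ - Aᵀ * A))).mulVec x) ⬝ᵥ y := by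
  intro x y
  have hJ : J6ᵀ = -J6 := by
    ext i j
    fin_cases i <;> fin_cases j <;> simp [J6]
  have hT : Aᵀ * J6 = J6 * Aᵀ := by
    have h := congrArg Matrix.transpose hA
    rw [Matrix.transpose_mul, Matrix.transpose_mul, hJ, Matrix.neg_mul, Matrix.mul_neg] at h
    exact (neg_injective h).symm
  have key : ∀ (B : Matrix (Fin 6) (Fin 6) ℝ) (u v : Fin 6 → ℝ),
      u ⬝ᵥ B.mulVec v = (Bᵀ.mulVec u) ⬝ᵥ v := by
    intro B u v
    rw [Matrix.dotProduct_mulVec, Matrix.mulVec_transpose]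
  have hM : J6 * ((A + Aᵀ)^2 - (A * Aᵀ - Aᵀ * A)) =
      J6 * Aᵀ * A + A * J6 * A + (Aᵀ * J6 * Aᵀ + Aᵀ * A * J6) := by
    rw [hA, hT, Matrix.mul_assoc Aᵀ A J6, hA, ← Matrix.mul_assoc Aᵀ J6 A, hT]
    noncomm_ring
  rw [hM]
  simp only [theta2, omega6, key, Matrix.transpose_mul, Matrix.transpose_transpose, Matrix.mulVec_mulVec,
    Matrix.add_mulVec, add_dotProduct, Matrix.mul_assoc]
  ring
end

section
/- Let e₁,…,e₆ be the standard basis of ℝ⁶, J ∈ M₆(ℝ) defined by Je₁=e₂, Je₂=−e₁, Je₃=e₄, Je₄=−e₃, Je₅=e₆, Je₆=−e₅, and write ℝ⁷ = ℝ⁶ ⊕ ℝe₇. Let φ be the alternating 3-form on ℝ⁷ given by φ = e¹∧e²∧e⁷ + e³∧e⁴∧e⁷ + e⁵∧e⁶∧e⁷ + e¹∧e³∧e⁵ − e¹∧e⁴∧e⁶ − e²∧e³∧e⁶ − e²∧e⁴∧e⁵. Suppose A ∈ M₆(ℝ) satisfies AJ = JA, tr(A) = 0 and tr(AJ) = 0.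 Set Q₁(A) := (1/2)[A,Aᵀ] + (1/12)·tr((A+Aᵀ)²)·I₆ − (1/2)(A+Aᵀ)², q(A) := −(1/6)·tr((A+Aᵀ)²), and let Q_A ∈ M₇(ℝ) be the block diagonal matrix diag(Q₁(A), q(A)). Then for all x, y, z ∈ ℝ⁷, (θ₇(Q_A)φ)(x,y,z) = α(πx,πy)·z₇ + α(πy,πz)·x₇ + α(πz,πx)·y₇, where α := θ(A)(θ(Aᵀ)ω) with ω(u,v) = ⟨Ju,v⟩ on ℝ⁶, π : ℝ⁷ → ℝ⁶ is the projection, and x₇ denotes the e₇-coordinate of x. -/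
open Matrix

/-- `Q₁(A) = (1/2)[A,Aᵀ] + (1/12)tr((A+Aᵀ)²)I − (1/2)(A+Aᵀ)²`. -/
noncomputable def Q1 (A : Matrix (Fin 6) (Fin 6) ℝ) : Matrix (Fin 6) (Fin 6) ℝ :=
  (1/2 : ℝ) • (A * Aᵀ - Aᵀ * A) + ((1/12 : ℝ) * ((A + Aᵀ)^2).trace) • (1 : Matrix (Fin 6) (Fin 6) ℝ)
    - (1/2 : ℝ) • (A + Aᵀ)^2

/-- `q(A) = −(1/6)tr((A+Aᵀ)²)`. -/
noncomputable def qA (A : Matrix (Fin 6) (Fin 6) ℝ) : ℝ := -(1/6) * ((A + Aᵀ)^2).trace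

lemma J6T : J6ᵀ = -J6 := by
  ext i j
  fin_cases i <;> fin_cases j <;> simp [J6]

lemma aux_comm (M : Matrix (Fin 6) (Fin 6) ℝ) (h : M * J6 = J6 * M) (i j : Fin 6) :
    (M * J6) i j = (J6 * M) i j := by rw [h]

lemma aux_one (M : Matrix (Fin 6) (Fin 6) ℝ) (q : ℝ) (h : M * J6 = J6 * M)
    (hs : Mᵀ = M) (ht : M.trace = 0) (x y z : Fin 7 → ℝ) :
    theta3 (blockDiag7 M q) phi7 x y z =
      -(omega6 (M *ᵥ proj76 x) (proj76 y) + omega6 (proj76 x) (M *ᵥ proj76 y)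
        + q * omega6 (proj76 x) (proj76 y)) * z 6
      + -(omega6 (M *ᵥ proj76 y) (proj76 z) + omega6 (proj76 y) (M *ᵥ proj76 z)
        + q * omega6 (proj76 y) (proj76 z)) * x 6
      + -(omega6 (M *ᵥ proj76 z) (proj76 x) + omega6 (proj76 z) (M *ᵥ proj76 x)
        + q * omega6 (proj76 z) (proj76 x)) * y 6 := by
  have hsym : ∀ i j, M j i = M i j := fun i j => congrFun (congrFun hs i) j
  have c := aux_comm M h
  have d00 : M 1 1 = M 0 0 := by
    have := c 1 0
    simpa [J6, Matrix.mul_apply, Fin.sum_univ_six] using this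
  have o00 : M 1 0 = -M 0 1 := by
    have := c 0 0
    simp [J6, Matrix.mul_apply, Fin.sum_univ_six] at this
    linarith
  have d01 : M 1 3 = M 0 2 := by
    have := c 1 2
    simpa [J6, Matrix.mul_apply, Fin.sum_univ_six] using this
  have o01 : M 1 2 = -M 0 3 := by
    have := c 0 2
    simp [J6, Matrix.mul_apply, Fin.sum_univ_six] at this
    linarith
  have d02 : M 1 5 = M 0 4 := by
    have := c 1 4
    simpa [J6, Matrix.mul_apply, Fin.sum_univ_six] using this
  have o02 : M 1 4 = -M 0 5 := by
    have := c 0 4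
    simp [J6, Matrix.mul_apply, Fin.sum_univ_six] at this
    linarith
  have d10 : M 3 1 = M 2 0 := by
    have := c 3 0
    simpa [J6, Matrix.mul_apply, Fin.sum_univ_six] using this
  have o10 : M 3 0 = -M 2 1 := by
    have := c 2 0
    simp [J6, Matrix.mul_apply, Fin.sum_univ_six] at this
    linarith
  have d11 : M 3 3 = M 2 2 := by
    have := c 3 2
    simpa [J6, Matrix.mul_apply, Fin.sum_univ_six] using this
  have o11 : M 3 2 = -M 2 3 := by
    have := c 2 2
    simp [J6, Matrix.mul_apply, Fin.sum_univ_six] at this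
    linarith
  have d12 : M 3 5 = M 2 4 := by
    have := c 3 4
    simpa [J6, Matrix.mul_apply, Fin.sum_univ_six] using this
  have o12 : M 3 4 = -M 2 5 := by
    have := c 2 4
    simp [J6, Matrix.mul_apply, Fin.sum_univ_six] at this
    linarith
  have d20 : M 5 1 = M 4 0 := by
    have := c 5 0
    simpa [J6, Matrix.mul_apply, Fin.sum_univ_six] using this
  have o20 : M 5 0 = -M 4 1 := by
    have := c 4 0
    simp [J6, Matrix.mul_apply, Fin.sum_univ_six] at this
    linarith
  have d21 : M 5 3 = M 4 2 := by
    have := c 5 2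
    simpa [J6, Matrix.mul_apply, Fin.sum_univ_six] using this
  have o21 : M 5 2 = -M 4 3 := by
    have := c 4 2
    simp [J6, Matrix.mul_apply, Fin.sum_univ_six] at this
    linarith
  have d22 : M 5 5 = M 4 4 := by
    have := c 5 4
    simpa [J6, Matrix.mul_apply, Fin.sum_univ_six] using this
  have o22 : M 5 4 = -M 4 5 := by
    have := c 4 4
    simp [J6, Matrix.mul_apply, Fin.sum_univ_six] at this
    linarith
  have z0 : M 0 1 = 0 := by
    have := hsym 0 1
    linarith
  have z1 : M 2 3 = 0 := by
    have := hsym 2 3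
    linarith
  have z2 : M 4 5 = 0 := by
    have := hsym 4 5
    linarith
  have t : M 4 4 = -M 0 0 - M 2 2 := by
    simp only [Matrix.trace, Matrix.diag_apply, Fin.sum_univ_six] at ht
    linarith
  have b : ∀ (v : Fin 7 → ℝ) (i : Fin 6),
      (blockDiag7 M q *ᵥ v) i.castSucc = (M *ᵥ proj76 v) i := by
    intro v i
    simp [Matrix.mulVec, dotProduct, Fin.sum_univ_castSucc, blockDiag7, proj76]
  have b6 : ∀ (v : Fin 7 → ℝ), (blockDiag7 M q *ᵥ v) 6 = q * v 6 := by
    intro v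
    simp [Matrix.mulVec, dotProduct, Fin.sum_univ_seven, blockDiag7]
  have b0 := fun v => b v 0
  have b1 := fun v => b v 1
  have b2 := fun v => b v 2
  have b3 := fun v => b v 3
  have b4 := fun v => b v 4
  have b5 := fun v => b v 5
  simp only [Fin.reduceCastSucc, Fin.castSucc_zero, Fin.castSucc_one] at b0 b1 b2 b3 b4 b5
  have w : ∀ u v : Fin 6 → ℝ, omega6 u v =
      u 0 * v 1 - u 1 * v 0 + u 2 * v 3 - u 3 * v 2 + u 4 * v 5 - u 5 * v 4 := by
    intro u v
    simp [omega6, J6, Matrix.mulVec, dotProduct, Fin.sum_univ_six]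
    ring
  have p : ∀ (v : Fin 7 → ℝ), proj76 v 0 = v 0 ∧ proj76 v 1 = v 1 ∧ proj76 v 2 = v 2 ∧
      proj76 v 3 = v 3 ∧ proj76 v 4 = v 4 ∧ proj76 v 5 = v 5 := by
    intro v
    exact ⟨rfl, rfl, rfl, rfl, rfl, rfl⟩
  have m : ∀ (v : Fin 7 → ℝ) (i : Fin 6), (M *ᵥ proj76 v) i =
      M i 0 * v 0 + M i 1 * v 1 + M i 2 * v 2 + M i 3 * v 3 + M i 4 * v 4 + M i 5 * v 5 := by
    intro v i
    simp only [Matrix.mulVec, dotProduct, Fin.sum_univ_six]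
    rfl
  simp only [theta3, phi7, w3, Matrix.det_fin_three, Matrix.of_apply, Matrix.cons_val,
    b0, b1, b2, b3, b4, b5, b6, w, p, m]
  simp only [d00, o00, d01, o01, d02, o02, d10, o10, d11, o11, d12, o12, d20, o20, d21, o21, d22, o22, z0, z1, z2, t]
  ring

lemma omega_adj (B : Matrix (Fin 6) (Fin 6) ℝ) (h : Bᵀ * J6 = J6 * Bᵀ) (u v : Fin 6 → ℝ) :
    omega6 u (B *ᵥ v) = omega6 (Bᵀ *ᵥ u) v := by
  unfold omega6
  rw [Matrix.dotProduct_mulVec, ← Matrix.mulVec_transpose, Matrix.mulVec_mulVec,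
    Matrix.mulVec_mulVec, h]

lemma omega_add (u u' v : Fin 6 → ℝ) : omega6 (u + u') v = omega6 u v + omega6 u' v := by
  simp [omega6, Matrix.mulVec_add, add_dotProduct]

lemma omega_smul (r : ℝ) (u v : Fin 6 → ℝ) : omega6 (r • u) v = r * omega6 u v := by
  simp [omega6, Matrix.mulVec_smul]

lemma commT (A : Matrix (Fin 6) (Fin 6) ℝ) (h : A * J6 = J6 * A) : Aᵀ * J6 = J6 * Aᵀ := by
  have := congrArg Matrix.transpose h
  rw [Matrix.transpose_mul, Matrix.transpose_mul, J6T, neg_mul, mul_neg] at this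
  exact (neg_injective this).symm

lemma Q1_symm (A : Matrix (Fin 6) (Fin 6) ℝ) : (Q1 A)ᵀ = Q1 A := by
  simp [Q1, pow_two, add_comm]

lemma Q1_comm (A : Matrix (Fin 6) (Fin 6) ℝ) (h : A * J6 = J6 * A) :
    Q1 A * J6 = J6 * Q1 A := by
  have c : Commute A J6 := h
  have c' : Commute Aᵀ J6 := commT A h
  have : Commute (Q1 A) J6 := by
    unfold Q1
    exact ((((c.mul_left c').sub_left (c'.mul_left c)).smul_left _).add_left
      ((Commute.one_left _).smul_left _)).sub_left (((c.add_left c').pow_left 2).smul_left _)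
  exact this

lemma Q1_trace (A : Matrix (Fin 6) (Fin 6) ℝ) : (Q1 A).trace = 0 := by
  simp only [Q1, Matrix.trace_sub, Matrix.trace_add, Matrix.trace_smul, Matrix.trace_one,
    Matrix.trace_mul_comm A Aᵀ, Fintype.card_fin, smul_eq_mul]
  push_cast
  ring

lemma Q1_twice (A : Matrix (Fin 6) (Fin 6) ℝ) :
    (2 : ℝ) • Q1 A + qA A • (1 : Matrix (Fin 6) (Fin 6) ℝ)
      = -(Aᵀ * A + A * A + Aᵀ * Aᵀ + Aᵀ * A) := by
  have e : (A + Aᵀ)^2 = A * A + A * Aᵀ + Aᵀ * A + Aᵀ * Aᵀ := by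
    noncomm_ring
  unfold Q1 qA
  generalize ((A + Aᵀ)^2).trace = t
  rw [e]
  module

lemma aux_two (A : Matrix (Fin 6) (Fin 6) ℝ) (h : A * J6 = J6 * A) (u v : Fin 6 → ℝ) :
    theta2 A (theta2 Aᵀ omega6) u v =
      -(omega6 (Q1 A *ᵥ u) v + omega6 u (Q1 A *ᵥ v) + qA A * omega6 u v) := by
  have h' := commT A h
  have a1 := omega_adj A h'
  have a2 := omega_adj Aᵀ (by simpa using h)
  rw [Matrix.transpose_transpose] at a2
  have a3 := omega_adj (Q1 A) (by rw [Q1_symm]; exact Q1_comm A h)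
  rw [Q1_symm] at a3
  have key : omega6 (((2 : ℝ) • Q1 A + qA A • (1 : Matrix (Fin 6) (Fin 6) ℝ)) *ᵥ u) v
      = omega6 ((-(Aᵀ * A + A * A + Aᵀ * Aᵀ + Aᵀ * A)) *ᵥ u) v := by rw [Q1_twice]
  have n : ∀ w : Fin 6 → ℝ, -w = (-1 : ℝ) • w := fun w => by simp
  simp only [Matrix.add_mulVec, Matrix.neg_mulVec, Matrix.smul_mulVec, Matrix.one_mulVec, n,
    omega_add, omega_smul] at key
  simp only [theta2, a1, a2, a3]
  simp only [Matrix.mulVec_mulVec]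
  linarith

/-- For `A ∈ sl(3,ℂ) ⊂ M₆(ℝ)` and `Q_A = diag(Q₁(A), q(A)) ∈ M₇(ℝ)`, the 3-form
`θ₇(Q_A)φ` equals `α ∧ e⁷`, where `α = θ(A)(θ(Aᵀ)ω)`; explicitly,
`(θ₇(Q_A)φ)(x,y,z) = α(πx,πy)z₇ + α(πy,πz)x₇ + α(πz,πx)y₇`. -/
theorem stmt6 (A : Matrix (Fin 6) (Fin 6) ℝ)
    (h1 : A * J6 = J6 * A) (h2 : A.trace = 0) (h3 : (A * J6).trace = 0) :
    ∀ x y z : Fin 7 → ℝ,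
      theta3 (blockDiag7 (Q1 A) (qA A)) phi7 x y z =
        theta2 A (theta2 Aᵀ omega6) (proj76 x) (proj76 y) * z ⟨6, by norm_num⟩
        + theta2 A (theta2 Aᵀ omega6) (proj76 y) (proj76 z) * x ⟨6, by norm_num⟩
        + theta2 A (theta2 Aᵀ omega6) (proj76 z) (proj76 x) * y ⟨6, by norm_num⟩ := by
  intro x y z
  rw [aux_one _ _ (Q1_comm A h1) (Q1_symm A) (Q1_trace A), aux_two A h1, aux_two A h1,
    aux_two A h1]
  rfl
end

section
/- Let e₁,…,e₆ be the standard basis of ℝ⁶ and J ∈ M₆(ℝ) defined by Je₁=e₂, Je₂=−e₁, Je₃=e₄, Je₄=−e₃, Je₅=e₆, Je₆=−e₅. Define B(A) := −(1/6)·tr((A+Aᵀ)²)·A + (1/2)·[A,[A,Aᵀ]] − (1/2)·[A,(A+Aᵀ)²] for A ∈ M₆(ℝ), where [X,Y] = XY − YX. If A satisfies AJ = JA, tr(A) = 0 and tr(AJ) = 0, then B(A) also satisfies B(A)J = J·B(A), tr(B(A)) = 0 and tr(B(A)·J) = 0. -/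
open Matrix

/-- The bracket flow vector field
`B(A) = −(1/6)tr((A+Aᵀ)²)A + (1/2)[A,[A,Aᵀ]] − (1/2)[A,(A+Aᵀ)²]`. -/
noncomputable def Bflow (A : Matrix (Fin 6) (Fin 6) ℝ) : Matrix (Fin 6) (Fin 6) ℝ :=
  (-(1/6) * ((A + Aᵀ)^2).trace) • A
    + (1/2 : ℝ) • (A * (A * Aᵀ - Aᵀ * A) - (A * Aᵀ - Aᵀ * A) * A)
    - (1/2 : ℝ) • (A * (A + Aᵀ)^2 - (A + Aᵀ)^2 * A)

/-- If `A ∈ M₆(ℝ)` satisfies `AJ = JA`, `tr A = 0` and `tr (AJ) = 0`, then so does `B(A)`: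
the family `sl(3,ℂ)` of closed `G₂`-structures is invariant under the bracket flow. -/
theorem stmt7 (A : Matrix (Fin 6) (Fin 6) ℝ)
    (h1 : A * J6 = J6 * A) (h2 : A.trace = 0) (h3 : (A * J6).trace = 0) :
    Bflow A * J6 = J6 * Bflow A ∧ (Bflow A).trace = 0 ∧ (Bflow A * J6).trace = 0 := by
  have hJ : J6ᵀ = -J6 := by
    ext i j
    fin_cases i <;> fin_cases j <;> simp [J6]
  have c1 : Commute A J6 := h1
  have c2 : Commute Aᵀ J6 := by
    have h := congrArg Matrix.transpose h1
    rw [Matrix.transpose_mul, Matrix.transpose_mul, hJ, Matrix.neg_mul, Matrix.mul_neg] at h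
    exact (neg_injective h).symm
  have cX : Commute (A * Aᵀ - Aᵀ * A) J6 := (c1.mul_left c2).sub_left (c2.mul_left c1)
  have cY : Commute ((A + Aᵀ) ^ 2) J6 := (c1.add_left c2).pow_left 2
  have t0 : ∀ X : Matrix (Fin 6) (Fin 6) ℝ, (A * X - X * A).trace = 0 := by
    intro X
    rw [Matrix.trace_sub, Matrix.trace_mul_comm, sub_self]
  have t1 : ∀ X : Matrix (Fin 6) (Fin 6) ℝ, ((A * X - X * A) * J6).trace = 0 := by
    intro X
    rw [Matrix.sub_mul, Matrix.trace_sub, Matrix.mul_assoc, Matrix.trace_mul_comm A,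
      Matrix.mul_assoc, ← h1, Matrix.mul_assoc, sub_self]
  refine ⟨?_, ?_, ?_⟩
  · have c : Commute (Bflow A) J6 := by
      unfold Bflow
      exact ((c1.smul_left _).add_left
        (((c1.mul_left cX).sub_left (cX.mul_left c1)).smul_left _)).sub_left
        (((c1.mul_left cY).sub_left (cY.mul_left c1)).smul_left _)
    exact c
  · unfold Bflow
    rw [Matrix.trace_sub, Matrix.trace_add, Matrix.trace_smul, Matrix.trace_smul,
      Matrix.trace_smul, t0, t0, h2]
    simp
  · unfold Bflow
    rw [Matrix.sub_mul, Matrix.add_mul, Matrix.smul_mul, Matrix.smul_mul, Matrix.smul_mul,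
      Matrix.trace_sub, Matrix.trace_add, Matrix.trace_smul, Matrix.trace_smul,
      Matrix.trace_smul, t1, t1, h3]
    simp
end

section
/- Identify ℝ⁷ = ℝ⁶ × ℝ. For A ∈ M₆(ℝ), let μ_A : ℝ⁷ × ℝ⁷ → ℝ⁷ be the skew-symmetric bilinear map μ_A((x,s),(y,t)) := (s·Ay − t·Ax, 0). For a linear map E on ℝ⁷ and a skew-symmetric bilinear map μ on ℝ⁷, define δ_μ(E)(u,v) := μ(Eu,v) + μ(u,Ev) − E·μ(u,v). Then for any Q₁ ∈ M₆(ℝ) and q ∈ ℝ, letting E := diag(Q₁, q) ∈ M₇(ℝ) (block diagonal), one has δ_{μ_A}(E) = μ_{qA + [A,Q₁]}, where [A,Q₁] = AQ₁ − Q₁A. -/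
open Matrix

/-- The Lie bracket `μ_A` of the almost abelian Lie algebra `ℝ⁷ = ℝ⁶ × ℝ` with abelian
ideal `ℝ⁶` and `ad e₇|_{ℝ⁶} = A`: `μ_A((x,s),(y,t)) = (s·Ay − t·Ax, 0)`. -/
noncomputable def muA (A : Matrix (Fin 6) (Fin 6) ℝ) :
    ((Fin 6 → ℝ) × ℝ) → ((Fin 6 → ℝ) × ℝ) → ((Fin 6 → ℝ) × ℝ) :=
  fun u v => (u.2 • A.mulVec v.1 - v.2 • A.mulVec u.1, 0)

/-- `δ_μ(E)(u,v) = μ(Eu,v) + μ(u,Ev) − E μ(u,v)`. -/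
noncomputable def deltaMu
    (μ : ((Fin 6 → ℝ) × ℝ) → ((Fin 6 → ℝ) × ℝ) → ((Fin 6 → ℝ) × ℝ))
    (E : ((Fin 6 → ℝ) × ℝ) → ((Fin 6 → ℝ) × ℝ)) :
    ((Fin 6 → ℝ) × ℝ) → ((Fin 6 → ℝ) × ℝ) → ((Fin 6 → ℝ) × ℝ) :=
  fun u v => μ (E u) v + μ u (E v) - E (μ u v)

/-- For `E = diag(Q₁, q)` one has `δ_{μ_A}(E) = μ_{qA + [A,Q₁]}`. -/
theorem stmt8 (A Q₁ : Matrix (Fin 6) (Fin 6) ℝ) (q : ℝ) :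
    deltaMu (muA A) (fun u => (Q₁.mulVec u.1, q * u.2)) =
      muA (q • A + (A * Q₁ - Q₁ * A)) := by
  funext u v
  obtain ⟨x, s⟩ := u
  obtain ⟨y, t⟩ := v
  refine Prod.ext ?_ ?_
  · simp only [deltaMu, muA, Prod.fst_add, Prod.fst_sub, Matrix.add_mulVec, Matrix.sub_mulVec,
      Matrix.smul_mulVec, Matrix.mulVec_sub, Matrix.mulVec_smul, ← Matrix.mulVec_mulVec]
    module
  · simp [deltaMu, muA]
end

section
/- Define B(A) := −(1/6)·tr((A+Aᵀ)²)·A + (1/2)·[A,[A,Aᵀ]] − (1/2)·[A,(A+Aᵀ)²] for A ∈ M₆(ℝ), where [X,Y] = XY − YX. Let I ⊆ ℝ be an open interval and A : I → M₆(ℝ) a curve such that A has derivative B(A(t)) at every t ∈ I. Then the function t ↦ tr(A(t)·A(t)ᵀ) is differentiable on I with derivative at t equal to −(1/3)·tr(A(t)A(t)ᵀ)·tr((A(t)+A(t)ᵀ)²) − tr([A(t),A(t)ᵀ]²); in particular this derivative is ≤ 0 at every t, with equality at t if and only if A(t)ᵀ = −A(t). -/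
open Matrix

attribute [local instance] Matrix.normedAddCommGroup Matrix.normedSpace

theorem aux_trace (A : Matrix (Fin 6) (Fin 6) ℝ) :
    2 * (Bflow A * Aᵀ).trace = -(1/3) * (A * Aᵀ).trace * ((A + Aᵀ)^2).trace
          - ((A * Aᵀ - Aᵀ * A)^2).trace := by
  unfold Bflow
  generalize ((A + Aᵀ)^2).trace = c
  generalize Aᵀ = P
  have h1 : (A * (P * (A * P))).trace = (P * (A * (P * A))).trace := by
    rw [Matrix.trace_mul_comm]; simp only [Matrix.mul_assoc]
  have h2 : (A * (A * (P * P))).trace = (P * (A * (A * P))).trace := by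
    rw [Matrix.trace_mul_comm P]; simp only [Matrix.mul_assoc]
  have h3 : (A * (P * (P * A))).trace = (A * (A * (P * P))).trace := by
    conv_rhs => rw [Matrix.trace_mul_comm]
    simp only [Matrix.mul_assoc]
  have h4 : (P * (P * (A * A))).trace = (A * (P * (P * A))).trace := by
    conv_rhs => rw [Matrix.trace_mul_comm]
    simp only [Matrix.mul_assoc]
  have h5 : (A * (A * (A * P))).trace = (A * (A * (P * A))).trace := by
    rw [Matrix.trace_mul_comm]; simp only [Matrix.mul_assoc]
  have h6 : (A * (P * (P * P))).trace = (P * (P * (A * P))).trace := by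
    rw [← Matrix.mul_assoc, Matrix.trace_mul_comm]; simp only [Matrix.mul_assoc]
  have h7 : (A * (P * (A * A))).trace = (A * (A * (P * A))).trace := by
    conv_rhs => rw [Matrix.trace_mul_comm]
    simp only [Matrix.mul_assoc]
  have h8 : (P * (A * (P * P))).trace = (P * (P * (A * P))).trace := by
    conv_rhs => rw [Matrix.trace_mul_comm]
    simp only [Matrix.mul_assoc]
  simp only [pow_two, Matrix.add_mul, Matrix.sub_mul, Matrix.mul_add, Matrix.mul_sub,
    Matrix.smul_mul, Matrix.trace_add, Matrix.trace_sub, Matrix.trace_smul, smul_eq_mul,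
    Matrix.mul_assoc, smul_sub, smul_add]
  linarith

theorem aux_nonneg (M : Matrix (Fin 6) (Fin 6) ℝ) : 0 ≤ (M * Mᵀ).trace := by
  simp only [Matrix.trace, Matrix.diag, Matrix.mul_apply, Matrix.transpose_apply]
  exact Finset.sum_nonneg fun i _ => Finset.sum_nonneg fun j _ => mul_self_nonneg _

theorem aux_zero (M : Matrix (Fin 6) (Fin 6) ℝ) (h : (M * Mᵀ).trace = 0) : M = 0 := by
  have := (Matrix.trace_mul_conjTranspose_self_eq_zero_iff (A := M)).1
  rw [Matrix.conjTranspose_eq_transpose_of_trivial] at this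
  exact this h

theorem aux_deriv (A : ℝ → Matrix (Fin 6) (Fin 6) ℝ) (B : Matrix (Fin 6) (Fin 6) ℝ) (t : ℝ)
    (h : HasDerivAt A B t) :
    HasDerivAt (fun s => (A s * (A s)ᵀ).trace) (2 * (B * (A t)ᵀ).trace) t := by
  have hij : ∀ i j, HasDerivAt (fun s => A s i j) (B i j) t := fun i j =>
    hasDerivAt_pi.1 (hasDerivAt_pi.1 h i) j
  simp only [Matrix.trace, Matrix.diag, Matrix.mul_apply, Matrix.transpose_apply, Finset.mul_sum]
  refine HasDerivAt.fun_sum fun i _ => HasDerivAt.fun_sum fun j _ => ?_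
  exact ((hij i j).mul (hij i j)).congr_deriv (by ring)

/-- Along the bracket flow `A' = B(A)` on an open interval, the squared norm
`|A|² = tr(AAᵀ)` evolves by `(|A|²)' = −(1/3)|A|²·tr((A+Aᵀ)²) − tr([A,Aᵀ]²)`;
in particular this derivative is `≤ 0`, with equality iff `Aᵀ = −A`. -/
theorem stmt10 (I : Set ℝ) (hIopen : IsOpen I) (hIint : I.OrdConnected)
    (A : ℝ → Matrix (Fin 6) (Fin 6) ℝ)
    (hA : ∀ t ∈ I, HasDerivAt A (Bflow (A t)) t) :
    ∀ t ∈ I,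
      HasDerivAt (fun s => (A s * (A s)ᵀ).trace)
        (-(1/3) * (A t * (A t)ᵀ).trace * ((A t + (A t)ᵀ)^2).trace
          - ((A t * (A t)ᵀ - (A t)ᵀ * A t)^2).trace) t
      ∧ (-(1/3) * (A t * (A t)ᵀ).trace * ((A t + (A t)ᵀ)^2).trace
          - ((A t * (A t)ᵀ - (A t)ᵀ * A t)^2).trace ≤ 0)
      ∧ (-(1/3) * (A t * (A t)ᵀ).trace * ((A t + (A t)ᵀ)^2).trace
          - ((A t * (A t)ᵀ - (A t)ᵀ * A t)^2).trace = 0 ↔ (A t)ᵀ = -(A t)) := by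
  intro t ht
  have hS : ((A t + (A t)ᵀ)^2) = (A t + (A t)ᵀ) * (A t + (A t)ᵀ)ᵀ := by
    rw [pow_two, Matrix.transpose_add, Matrix.transpose_transpose, add_comm (A t)ᵀ]
  have hC : ((A t * (A t)ᵀ - (A t)ᵀ * A t)^2)
      = (A t * (A t)ᵀ - (A t)ᵀ * A t) * (A t * (A t)ᵀ - (A t)ᵀ * A t)ᵀ := by
    rw [pow_two, Matrix.transpose_sub, Matrix.transpose_mul, Matrix.transpose_mul,
      Matrix.transpose_transpose]
  have nA := aux_nonneg (A t)
  have nS := aux_nonneg (A t + (A t)ᵀ)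
  have nC := aux_nonneg (A t * (A t)ᵀ - (A t)ᵀ * A t)
  rw [← hS] at nS
  rw [← hC] at nC
  have nAS := mul_nonneg nA nS
  refine ⟨?_, by linarith, ?_, ?_⟩
  · rw [← aux_trace]
    exact aux_deriv A _ t (hA t ht)
  · intro h
    have h0 : (A t * (A t)ᵀ).trace * ((A t + (A t)ᵀ)^2).trace = 0 := by linarith
    rcases mul_eq_zero.1 h0 with h1 | h1
    · rw [aux_zero _ h1]; simp
    · rw [hS] at h1
      exact eq_neg_of_add_eq_zero_right (aux_zero _ h1)
  · intro h
    rw [h]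
    simp
end

section
/- Let e₁,…,e₆ be the standard basis of ℝ⁶ and J ∈ M₆(ℝ) defined by Je₁=e₂, Je₂=−e₁, Je₃=e₄, Je₄=−e₃, Je₅=e₆, Je₆=−e₅. Define B(A) := −(1/6)·tr((A+Aᵀ)²)·A + (1/2)·[A,[A,Aᵀ]] − (1/2)·[A,(A+Aᵀ)²]. Then for every A₀ ∈ M₆(ℝ) with A₀J = JA₀, tr(A₀) = 0 and tr(A₀J) = 0, there exist ε > 0 and a differentiable curve A : (−ε, ∞) → M₆(ℝ) with A(0) = A₀ such that A has derivative B(A(t)) at every t ∈ (−ε, ∞). -/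
open Matrix

attribute [local instance] Matrix.normedAddCommGroup Matrix.normedSpace

lemma glob_ode {E : Type*} [NormedAddCommGroup E] [NormedSpace ℝ E] [CompleteSpace E]
    (g : E → E) (K L : NNReal) (hK : LipschitzWith K g) (hL : ∀ x, ‖g x‖ ≤ L) (x₀ : E) :
    ∃ α : ℝ → E, α 0 = x₀ ∧ ∀ t, HasDerivAt α (g (α t)) t := by
  have hloc : ∀ n : ℕ, ∃ α : ℝ → E, α 0 = x₀ ∧
      ∀ t ∈ Set.Ioo (-((n:ℝ)+1)) ((n:ℝ)+1), HasDerivAt α (g (α t)) t := by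
    intro n
    have h0 : (0:ℝ) ∈ Set.Icc (-((n:ℝ)+1)) ((n:ℝ)+1) := by
      constructor <;> linarith [(Nat.cast_nonneg n : (0:ℝ) ≤ n)]
    have hp : IsPicardLindelof (fun _ => g) (⟨0, h0⟩ : Set.Icc (-((n:ℝ)+1)) ((n:ℝ)+1)) x₀
        (L * (n+1)) 0 L K := by
      apply IsPicardLindelof.of_time_independent
      · intro x _; exact hL x
      · exact hK.lipschitzOnWith
      · simp
    obtain ⟨α, h, hα⟩ := hp.exists_eq_forall_mem_Icc_hasDerivWithinAt₀
    exact ⟨α, h, fun t ht => (hα t (Set.Ioo_subset_Icc_self ht)).hasDerivAt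
      (Icc_mem_nhds ht.1 ht.2)⟩
  choose α h0 hα using hloc
  have huniq : ∀ m n : ℕ, m ≤ n → ∀ t ∈ Set.Ioo (-((m:ℝ)+1)) ((m:ℝ)+1), α m t = α n t := by
    intro m n hmn
    have hc : (m:ℝ) ≤ n := by exact_mod_cast hmn
    have hm : (0:ℝ) ≤ m := Nat.cast_nonneg m
    have := ODE_solution_unique_of_mem_Ioo (v := fun _ => g) (s := fun _ => Set.univ) (K := K)
      (f := α m) (g := α n) (t₀ := 0) (a := -((m:ℝ)+1)) (b := (m:ℝ)+1)
      (fun t _ => hK.lipschitzOnWith) (by constructor <;> linarith)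
      (fun t ht => ⟨hα m t ht, trivial⟩)
      (fun t ht => ⟨hα n t ⟨by linarith [ht.1], by linarith [ht.2]⟩, trivial⟩)
      (by rw [h0, h0])
    exact this
  refine ⟨fun t => α ⌈|t|⌉₊ t, by simp [h0], fun t => ?_⟩
  have key : ∀ (n : ℕ) (s : ℝ), |s| < (n:ℝ) + 1 → α ⌈|s|⌉₊ s = α n s := by
    intro n s hs
    have h1 : |s| < (⌈|s|⌉₊ : ℝ) + 1 := by linarith [Nat.le_ceil |s|]
    rcases le_total n ⌈|s|⌉₊ with h | h
    · exact (huniq _ _ h s (abs_lt.mp hs)).symm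
    · exact huniq _ _ h s (abs_lt.mp h1)
  set n := ⌈|t|⌉₊ with hn
  have ht : |t| < (n:ℝ) + 1 := by linarith [Nat.le_ceil |t|]
  refine (hα n t (abs_lt.mp ht)).congr_of_eventuallyEq ?_
  filter_upwards [(isOpen_lt continuous_abs continuous_const).mem_nhds ht] with s hs
  exact key n s hs

lemma Bflow_contDiff : ContDiff ℝ 1 Bflow := by
  refine contDiff_pi.2 fun i => contDiff_pi.2 fun j => ?_
  have hA : ∀ i j, ContDiff ℝ 1 (fun A : Matrix (Fin 6) (Fin 6) ℝ => A i j) :=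
    fun i j => contDiff_apply_apply ℝ ℝ i j
  simp only [Bflow, pow_two, Matrix.trace, Matrix.diag, Matrix.mul_apply, Matrix.add_apply,
    Matrix.sub_apply, Matrix.smul_apply, Matrix.transpose_apply, smul_eq_mul]
  fun_prop

lemma sq_trace_nonneg (C : Matrix (Fin 6) (Fin 6) ℝ) (h : Cᵀ = C) : 0 ≤ (C * C).trace := by
  have : (C * C).trace = (C * Cᵀ).trace := by rw [h]
  rw [this]
  simp only [Matrix.trace, Matrix.diag, Matrix.mul_apply, Matrix.transpose_apply]
  exact Finset.sum_nonneg fun i _ => Finset.sum_nonneg fun j _ => mul_self_nonneg _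

lemma Bflow_trace (A : Matrix (Fin 6) (Fin 6) ℝ) : (Bflow A * Aᵀ).trace ≤ 0 := by
  have h1 := sq_trace_nonneg (A + Aᵀ) (by simp [add_comm])
  have h2 := sq_trace_nonneg (A * Aᵀ - Aᵀ * A) (by simp)
  have h3 : 0 ≤ (A * Aᵀ).trace := by
    simp only [Matrix.trace, Matrix.diag, Matrix.mul_apply, Matrix.transpose_apply]
    exact Finset.sum_nonneg fun i _ => Finset.sum_nonneg fun j _ => mul_self_nonneg _
  have key : (Bflow A * Aᵀ).trace = -(1/6) * (((A + Aᵀ) * (A + Aᵀ)).trace * (A * Aᵀ).trace)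
      - 1/2 * ((A * Aᵀ - Aᵀ * A) * (A * Aᵀ - Aᵀ * A)).trace := by
    have e1 := Matrix.trace_mul_comm (A * A * A) Aᵀ
    have e2 := Matrix.trace_mul_comm (A * A * Aᵀ) A
    have e3 := Matrix.trace_mul_comm (A * Aᵀ * A) A
    have e4 := Matrix.trace_mul_comm (Aᵀ * A * A) A
    have f1 := Matrix.trace_mul_comm (Aᵀ * Aᵀ * Aᵀ) A
    have f2 := Matrix.trace_mul_comm (Aᵀ * Aᵀ * A) Aᵀ
    have f3 := Matrix.trace_mul_comm (Aᵀ * A * Aᵀ) Aᵀ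
    have f4 := Matrix.trace_mul_comm (A * Aᵀ * Aᵀ) Aᵀ
    have g1 := Matrix.trace_mul_comm (A * Aᵀ * A) Aᵀ
    have g2 := Matrix.trace_mul_comm (A * A * Aᵀ) Aᵀ
    have g3 := Matrix.trace_mul_comm (A * Aᵀ * Aᵀ) A
    have g4 := Matrix.trace_mul_comm (Aᵀ * Aᵀ * A) A
    have g5 := Matrix.trace_mul_comm (Aᵀ * A * A) Aᵀ
    simp only [Bflow, pow_two, mul_add, add_mul, mul_sub, sub_mul, smul_mul_assoc, Matrix.trace_add,
      Matrix.trace_sub, Matrix.trace_smul, smul_eq_mul, ← mul_assoc, smul_add, smul_sub] at *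
    linarith
  rw [key]
  nlinarith [mul_nonneg h1 h3]

lemma deriv_N (A : ℝ → Matrix (Fin 6) (Fin 6) ℝ) (A' : Matrix (Fin 6) (Fin 6) ℝ) (t : ℝ)
    (h : HasDerivAt A A' t) :
    HasDerivAt (fun s => ∑ i, ∑ j, (A s i j) ^ 2) (2 * (A' * (A t)ᵀ).trace) t := by
  have hij : ∀ i j, HasDerivAt (fun s => A s i j) (A' i j) t := fun i j =>
    hasDerivAt_pi.1 (hasDerivAt_pi.1 h i) j
  have := HasDerivAt.fun_sum (u := Finset.univ) fun i (_ : i ∈ Finset.univ) =>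
    HasDerivAt.fun_sum (u := Finset.univ) fun j (_ : j ∈ Finset.univ) => (hij i j).fun_pow 2
  refine this.congr_deriv ?_
  simp only [Matrix.trace, Matrix.diag, Matrix.mul_apply, Matrix.transpose_apply, Finset.mul_sum]
  refine Finset.sum_congr rfl fun i _ => Finset.sum_congr rfl fun j _ => ?_
  push_cast; ring

lemma norm_le_N (A : Matrix (Fin 6) (Fin 6) ℝ) (c : ℝ) (h : ∑ i, ∑ j, (A i j) ^ 2 ≤ c) :
    ‖A‖ ≤ Real.sqrt c := by
  rw [Matrix.norm_le_iff (Real.sqrt_nonneg _)]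
  intro i j
  apply Real.abs_le_sqrt
  refine le_trans ?_ h
  refine le_trans ?_ (Finset.single_le_sum (f := fun i => ∑ j, (A i j) ^ 2)
    (fun i _ => Finset.sum_nonneg fun j _ => sq_nonneg _) (Finset.mem_univ i))
  exact Finset.single_le_sum (f := fun j => (A i j) ^ 2)
    (fun j _ => sq_nonneg _) (Finset.mem_univ j)

/-- Immortality of the bracket flow: for every `A₀ ∈ sl(3,ℂ) ⊂ M₆(ℝ)` there
exist `ε > 0` and a solution `A` of `A' = B(A)` on `(-ε, ∞)` with `A(0) = A₀`. -/
theorem stmt12 (A₀ : Matrix (Fin 6) (Fin 6) ℝ)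
    (h1 : A₀ * J6 = J6 * A₀) (h2 : A₀.trace = 0) (h3 : (A₀ * J6).trace = 0) :
    ∃ ε > (0:ℝ), ∃ A : ℝ → Matrix (Fin 6) (Fin 6) ℝ,
      A 0 = A₀ ∧ ∀ t ∈ Set.Ioi (-ε), HasDerivAt A (Bflow (A t)) t := by
  set c : ℝ := ∑ i, ∑ j, (A₀ i j) ^ 2 with hc
  have hR : 0 ≤ Real.sqrt c := Real.sqrt_nonneg c
  let χ : ContDiffBump (0 : Matrix (Fin 6) (Fin 6) ℝ) :=
    ⟨Real.sqrt c + 1, Real.sqrt c + 2, by linarith, by linarith⟩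
  let g : Matrix (Fin 6) (Fin 6) ℝ → Matrix (Fin 6) (Fin 6) ℝ := fun A => χ A • Bflow A
  have hg : ContDiff ℝ 1 g := χ.contDiff.smul Bflow_contDiff
  have hs : HasCompactSupport g := χ.hasCompactSupport.smul_right
  obtain ⟨K, hK⟩ := ContDiff.lipschitzWith_of_hasCompactSupport hs hg (by simp)
  obtain ⟨L, hL⟩ := hs.exists_bound_of_continuous hg.continuous
  obtain ⟨A, hA0, hA⟩ := glob_ode g K L.toNNReal hK
    (fun x => (hL x).trans (Real.le_coe_toNNReal L)) A₀
  have heq : ∀ X : Matrix (Fin 6) (Fin 6) ℝ, ‖X‖ ≤ Real.sqrt c + 1 → g X = Bflow X := by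
    intro X hX
    have : χ X = 1 := χ.one_of_mem_closedBall (by simpa [χ] using hX)
    simp [g, this]
  have hN : Antitone (fun s => ∑ i, ∑ j, (A s i j) ^ 2) := by
    refine antitone_of_hasDerivAt_nonpos (fun t => deriv_N A _ t (hA t)) fun t => ?_
    simp only [g, smul_mul_assoc, Matrix.trace_smul, smul_eq_mul]
    have := mul_nonneg (χ.nonneg (x := A t)) (neg_nonneg.2 (Bflow_trace (A t)))
    simp only [Pi.zero_apply]
    linarith
  have hpos : ∀ t, 0 ≤ t → ‖A t‖ ≤ Real.sqrt c := by
    intro t ht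
    apply norm_le_N
    have := hN ht
    simpa [hA0] using this
  have hcont : ContinuousAt A 0 := (hA 0).continuousAt
  have hev : ∀ᶠ s in nhds (0:ℝ), ‖A s‖ < Real.sqrt c + 1 :=
    hcont.norm.eventually_lt continuousAt_const (by linarith [hpos 0 le_rfl])
  obtain ⟨ε, hε, hb⟩ := Metric.eventually_nhds_iff.1 hev
  refine ⟨ε, hε, A, hA0, fun t ht => ?_⟩
  have : ‖A t‖ ≤ Real.sqrt c + 1 := by
    rcases le_total 0 t with h | h
    · linarith [hpos t h]
    · refine (hb ?_).le
      rw [Real.dist_eq, sub_zero, abs_of_nonpos h]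
      have : -ε < t := ht
      linarith
  rw [← heq _ this]
  exact hA t
end

section
/- Define B(A) := −(1/6)·tr((A+Aᵀ)²)·A + (1/2)·[A,[A,Aᵀ]] − (1/2)·[A,(A+Aᵀ)²] for A ∈ M₆(ℝ). Let I ⊆ ℝ be an open interval and A : I → M₆(ℝ) a curve with derivative B(A(t)) at every t ∈ I. Then the function t ↦ tr((A(t)+A(t)ᵀ)²) is differentiable on I with derivative at t equal to −(1/3)·(tr((A(t)+A(t)ᵀ)²))² − 2·tr([A(t),A(t)ᵀ]²). -/
open Matrix

attribute [local instance] Matrix.normedAddCommGroup Matrix.normedSpace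

theorem bflow_trace (M : Matrix (Fin 6) (Fin 6) ℝ) :
    2 * ((M + Mᵀ) * (Bflow M + (Bflow M)ᵀ)).trace =
      -(1/3) * (((M + Mᵀ)^2).trace)^2 - 2 * ((M * Mᵀ - Mᵀ * M)^2).trace := by
  have key : ∀ X : Matrix (Fin 6) (Fin 6) ℝ,
      ((M + Mᵀ) * Xᵀ).trace = ((M + Mᵀ) * X).trace := by
    intro X
    rw [← Matrix.trace_transpose, Matrix.transpose_mul, Matrix.transpose_transpose,
      Matrix.transpose_add, Matrix.transpose_transpose, Matrix.trace_mul_comm, add_comm Mᵀ M]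
  have comm : ∀ S X : Matrix (Fin 6) (Fin 6) ℝ,
      (S * (M * X - X * M)).trace = ((S * M - M * S) * X).trace := by
    intro S X
    rw [mul_sub, sub_mul, Matrix.trace_sub, Matrix.trace_sub, ← mul_assoc, ← mul_assoc,
      Matrix.trace_mul_comm (S * X) M, ← mul_assoc]
  have h1 : ((M + Mᵀ) * M).trace = (1/2) * ((M + Mᵀ)^2).trace := by
    have := key M
    rw [pow_two, mul_add (M + Mᵀ) M Mᵀ, Matrix.trace_add, this]
    ring
  have h2 : ((M + Mᵀ) * (M * (M * Mᵀ - Mᵀ * M) - (M * Mᵀ - Mᵀ * M) * M)).trace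
      = -((M * Mᵀ - Mᵀ * M)^2).trace := by
    rw [comm, ← Matrix.trace_neg]
    congr 1
    noncomm_ring
  have h3 : ((M + Mᵀ) * (M * (M + Mᵀ)^2 - (M + Mᵀ)^2 * M)).trace = 0 := by
    generalize M + Mᵀ = S
    rw [comm, sub_mul, Matrix.trace_sub, mul_assoc, Matrix.trace_mul_comm S, mul_assoc, mul_assoc,
      ← pow_succ, ← pow_succ', sub_self]
  have h : ((M + Mᵀ) * Bflow M).trace = -(1/12) * (((M + Mᵀ)^2).trace)^2
      - (1/2) * ((M * Mᵀ - Mᵀ * M)^2).trace := by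
    unfold Bflow
    rw [mul_sub, mul_add (M + Mᵀ), Matrix.trace_sub, Matrix.trace_add, Matrix.mul_smul,
      Matrix.mul_smul, Matrix.mul_smul, Matrix.trace_smul, Matrix.trace_smul, Matrix.trace_smul,
      h1, h2, h3]
    simp only [smul_eq_mul]
    ring
  rw [mul_add (M + Mᵀ) (Bflow M), Matrix.trace_add, key, h]
  ring

/-- Along the bracket flow `A' = B(A)` on an open interval, the quantity
`tr((A+Aᵀ)²)` evolves by `(tr((A+Aᵀ)²))' = −(1/3)(tr((A+Aᵀ)²))² − 2 tr([A,Aᵀ]²)`. -/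
theorem stmt13 (I : Set ℝ) (hIopen : IsOpen I) (hIint : I.OrdConnected)
    (A : ℝ → Matrix (Fin 6) (Fin 6) ℝ)
    (hA : ∀ t ∈ I, HasDerivAt A (Bflow (A t)) t) :
    ∀ t ∈ I,
      HasDerivAt (fun s => ((A s + (A s)ᵀ)^2).trace)
        (-(1/3) * (((A t + (A t)ᵀ)^2).trace)^2
          - 2 * ((A t * (A t)ᵀ - (A t)ᵀ * A t)^2).trace) t := by
  intro t ht
  have hd := hA t ht
  have he : ∀ i j, HasDerivAt (fun s => A s i j) (Bflow (A t) i j) t := fun i j =>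
    hasDerivAt_pi.1 (hasDerivAt_pi.1 hd i) j
  have hS : ∀ i j, HasDerivAt (fun s => A s i j + A s j i)
      (Bflow (A t) i j + Bflow (A t) j i) t := fun i j => (he i j).add (he j i)
  rw [← bflow_trace]
  have hsum : HasDerivAt
      (fun s => ∑ i, ∑ j, (A s i j + A s j i) * (A s j i + A s i j))
      (∑ i, ∑ j, ((Bflow (A t) i j + Bflow (A t) j i) * (A t j i + A t i j)
        + (A t i j + A t j i) * (Bflow (A t) j i + Bflow (A t) i j))) t :=
    HasDerivAt.fun_sum fun i _ => HasDerivAt.fun_sum fun j _ => (hS i j).mul (hS j i)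
  convert hsum using 1
  · funext s
    simp only [pow_two, Matrix.trace, Matrix.diag_apply, Matrix.mul_apply, Matrix.add_apply,
      Matrix.transpose_apply]
  · simp only [Matrix.trace, Matrix.diag_apply, Matrix.mul_apply, Matrix.add_apply,
      Matrix.transpose_apply, Finset.mul_sum]
    refine Finset.sum_congr rfl fun i _ => Finset.sum_congr rfl fun j _ => ?_
    ring
end

section
/- Let e₁,…,e₆ be the standard basis of ℝ⁶ and J ∈ M₆(ℝ) defined by Je₁=e₂, Je₂=−e₁, Je₃=e₄, Je₄=−e₃, Je₅=e₆, Je₆=−e₅. For A ∈ M₆(ℝ) set Q₁(A) := (1/2)[A,Aᵀ] + (1/12)·tr((A+Aᵀ)²)·I₆ − (1/2)(A+Aᵀ)² and q(A) := −(1/6)·tr((A+Aᵀ)²). Let A ∈ M₆(ℝ) be nonzero with AJ = JA, tr(A) = 0 and tr(AJ) = 0. Then there exists c ∈ ℝ with Q₁(A)·A − A·Q₁(A) = (q(A) − c)·A if and only if either [A,Aᵀ] = 0, or A is nilpotent and tr(AAᵀ)·[A, [A,Aᵀ] − (A+Aᵀ)²] = −tr([A,Aᵀ]²)·A. Moreover,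 in that case the (unique) such c equals q(A) − tr([A,Aᵀ]²)/(2·tr(AAᵀ)). -/
open Matrix

abbrev M6 := Matrix (Fin 6) (Fin 6) ℝ

lemma trace_mul_transpose_ne (A : M6) (hA : A ≠ 0) : (A * Aᵀ).trace ≠ 0 := by
  intro h
  apply hA
  have := Matrix.trace_mul_conjTranspose_self_eq_zero_iff (A := A)
  rw [Matrix.conjTranspose_eq_transpose_of_trivial] at this
  exact this.1 h

lemma nilp_of_comm (D A : M6) (l : ℝ) (hl : l ≠ 0) (h : D * A - A * D = l • A) :
    IsNilpotent A := by
  have hk : ∀ k : ℕ, D * A ^ k - A ^ k * D = ((k : ℝ) * l) • A ^ k := by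
    intro k
    induction k with
    | zero => simp
    | succ k ih =>
      have e : D * A ^ (k+1) - A ^ (k+1) * D
          = (D * A ^ k - A ^ k * D) * A + A ^ k * (D * A - A * D) := by
        rw [pow_succ]; noncomm_ring
      rw [e, ih, h, pow_succ, smul_mul_assoc, mul_smul_comm, ← add_smul]
      congr 1
      push_cast
      ring
  by_contra hn
  have hne : ∀ k : ℕ, A ^ k ≠ 0 := fun k hk0 => hn ⟨k, hk0⟩
  let f : Module.End ℝ M6 := LinearMap.mulLeft ℝ D - LinearMap.mulRight ℝ D
  have hfin : {m : ℝ | f.HasEigenvalue m}.Finite := Module.End.finite_hasEigenvalue f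
  have hinj : Function.Injective (fun k : ℕ => (k : ℝ) * l) := by
    intro a b hab
    have := mul_right_cancel₀ hl hab
    exact_mod_cast this
  refine Set.infinite_of_injective_forall_mem hinj (fun k => ?_) hfin
  refine Module.End.hasEigenvalue_of_hasEigenvector (x := A ^ k) ⟨?_, hne k⟩
  rw [Module.End.mem_eigenspace_iff]
  simpa [f] using hk k

lemma comm_Q1 (A : M6) : A * ((A * Aᵀ - Aᵀ * A) - (A + Aᵀ)^2)
    - ((A * Aᵀ - Aᵀ * A) - (A + Aᵀ)^2) * A = (-2 : ℝ) • (Q1 A * A - A * Q1 A) := by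
  unfold Q1
  generalize (A * Aᵀ - Aᵀ * A) = N
  generalize ((A + Aᵀ)^2).trace = t
  generalize (A + Aᵀ)^2 = S
  simp only [sub_mul, add_mul, mul_sub, mul_add, smul_mul_assoc, mul_smul_comm, one_mul, mul_one]
  module

lemma trace_key (A : M6) : ((Q1 A * A - A * Q1 A) * Aᵀ).trace
    = ((A * Aᵀ - Aᵀ * A)^2).trace / 2 := by
  have h0 : ((Q1 A * A - A * Q1 A) * Aᵀ).trace = (Q1 A * (A * Aᵀ - Aᵀ * A)).trace := by
    rw [sub_mul, mul_sub, trace_sub, trace_sub, mul_assoc, mul_assoc A, trace_mul_comm A, mul_assoc]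
  have hS : ((A + Aᵀ)^2 * (A * Aᵀ - Aᵀ * A)).trace = 0 := by
    generalize Aᵀ = B
    have c1 := trace_mul_comm A (A * A * B)
    have c2 := trace_mul_comm B (B * B * A)
    have c3 := trace_mul_comm A (B * A * B)
    have c4 := trace_mul_comm A (A * B * B)
    have c5 := trace_mul_comm B (B * A * A)
    have c6 := trace_mul_comm A (B * B * A)
    have c7 := trace_mul_comm B (A * A * B)
    have c8 := trace_mul_comm B (A * B * B)
    have c9 := trace_mul_comm A (B * A * A)
    have c10 := trace_mul_comm B (B * A * B)
    have c11 := trace_mul_comm A (A * B * A)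
    have c12 := trace_mul_comm B (A * B * A)
    simp only [sq, mul_add, add_mul, mul_sub, sub_mul, trace_add, trace_sub, mul_assoc] at *
    linarith
  rw [h0]
  have hN : (A * Aᵀ - Aᵀ * A).trace = 0 := by rw [trace_sub, trace_mul_comm, sub_self]
  unfold Q1
  rw [sub_mul, add_mul, smul_mul_assoc, smul_mul_assoc, smul_mul_assoc, one_mul, trace_sub,
    trace_add, trace_smul, trace_smul, trace_smul, hS, hN, ← sq]
  simp only [smul_eq_mul]
  ring

lemma soliton_val (A : M6) (l : ℝ) (h : Q1 A * A - A * Q1 A = l • A) :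
    ((A * Aᵀ - Aᵀ * A)^2).trace = 2 * l * (A * Aᵀ).trace := by
  have := trace_key A
  rw [h, smul_mul_assoc, trace_smul, smul_eq_mul] at this
  linarith

/-- Algebraic soliton condition for a nonzero `A ∈ sl(3,ℂ) ⊂ M₆(ℝ)`:
`∃ c, [Q₁(A),A] = (q(A)−c)A` iff `A` is normal, or `A` is nilpotent and
`tr(AAᵀ)·[A,[A,Aᵀ]−(A+Aᵀ)²] = −tr([A,Aᵀ]²)·A`; moreover any such `c` equals
`q(A) − tr([A,Aᵀ]²)/(2 tr(AAᵀ))`. -/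
theorem stmt15 (A : Matrix (Fin 6) (Fin 6) ℝ) (hA : A ≠ 0)
    (h1 : A * J6 = J6 * A) (h2 : A.trace = 0) (h3 : (A * J6).trace = 0) :
    ((∃ c : ℝ, Q1 A * A - A * Q1 A = (qA A - c) • A) ↔
      (A * Aᵀ - Aᵀ * A = 0 ∨
        (IsNilpotent A ∧
          (A * Aᵀ).trace •
              (A * ((A * Aᵀ - Aᵀ * A) - (A + Aᵀ)^2)
                - ((A * Aᵀ - Aᵀ * A) - (A + Aᵀ)^2) * A)
            = (-((A * Aᵀ - Aᵀ * A)^2).trace) • A)))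
    ∧ ∀ c : ℝ, Q1 A * A - A * Q1 A = (qA A - c) • A →
        c = qA A - ((A * Aᵀ - Aᵀ * A)^2).trace / (2 * (A * Aᵀ).trace) := by
  have ht := trace_mul_transpose_ne A hA
  have hu : ∀ c : ℝ, Q1 A * A - A * Q1 A = (qA A - c) • A →
        c = qA A - ((A * Aᵀ - Aᵀ * A)^2).trace / (2 * (A * Aᵀ).trace) := by
    intro c hc
    rw [soliton_val A _ hc]
    field_simp
    ring
  refine ⟨⟨?_, ?_⟩, hu⟩
  · rintro ⟨c, hc⟩
    have hv := soliton_val A _ hc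
    by_cases hl : qA A - c = 0
    · left
      rw [hl] at hv
      by_contra hN
      apply trace_mul_transpose_ne _ hN
      have : (A * Aᵀ - Aᵀ * A)ᵀ = A * Aᵀ - Aᵀ * A := by simp [transpose_mul]
      rw [this, ← sq, hv]; ring
    · right
      refine ⟨nilp_of_comm _ A _ hl hc, ?_⟩
      rw [comm_Q1, hc, hv, smul_smul, smul_smul]
      congr 1
      ring
  · rintro (hN | ⟨-, h⟩)
    · refine ⟨qA A, ?_⟩
      have hN' : A * Aᵀ = Aᵀ * A := sub_eq_zero.1 hN
      have hc : Commute A (A + Aᵀ) := (Commute.refl A).add_right hN'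
      have hc2 : A * (A + Aᵀ)^2 = (A + Aᵀ)^2 * A := hc.pow_right 2
      have := comm_Q1 A
      rw [hN, zero_sub, mul_neg, neg_mul, hc2, sub_self] at this
      rw [sub_self, zero_smul]
      exact (smul_eq_zero.1 this.symm).resolve_left (by norm_num)
    · refine ⟨qA A - ((A * Aᵀ - Aᵀ * A)^2).trace / (2 * (A * Aᵀ).trace), ?_⟩
      rw [comm_Q1, smul_smul] at h
      have hne : (A * Aᵀ).trace * (-2) ≠ 0 := mul_ne_zero ht (by norm_num)
      apply smul_right_injective _ hne
      simp only []
      rw [h, smul_smul]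
      congr 1
      field_simp
      ring
end

section
/- For A ∈ M₆(ℝ) set Q₁(A) := (1/2)[A,Aᵀ] + (1/12)·tr((A+Aᵀ)²)·I₆ − (1/2)(A+Aᵀ)². Let A, D₁ ∈ M₆(ℝ) and c, d ∈ ℝ with A ≠ 0. If Q₁(A) = c·I₆ + (1/2)(D₁ + D₁ᵀ) and D₁·A − A·D₁ = d·A, then d·tr(AAᵀ) = (1/2)·tr([A,Aᵀ]²). -/
open Matrix

/-- The soliton constant: if `Q₁(A) = cI + (1/2)(D₁+D₁ᵀ)` and `[D₁,A] = dA` with `A ≠ 0`,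
then `d·tr(AAᵀ) = (1/2)·tr([A,Aᵀ]²)`. -/
theorem stmt16 (A D₁ : Matrix (Fin 6) (Fin 6) ℝ) (c d : ℝ) (hA : A ≠ 0)
    (hQ : Q1 A = c • (1 : Matrix (Fin 6) (Fin 6) ℝ) + (1/2 : ℝ) • (D₁ + D₁ᵀ))
    (hD : D₁ * A - A * D₁ = d • A) :
    d * (A * Aᵀ).trace = (1/2) * ((A * Aᵀ - Aᵀ * A)^2).trace := by
  have hS : (1/2 : ℝ) • (D₁ + D₁ᵀ) = Q1 A - c • (1 : Matrix (Fin 6) (Fin 6) ℝ) := by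
    rw [hQ]; abel
  have h1 : d * (A * Aᵀ).trace = (D₁ * (A * Aᵀ - Aᵀ * A)).trace := by
    have h : ((D₁ * A - A * D₁) * Aᵀ).trace = d * (A * Aᵀ).trace := by
      rw [hD]; simp
    rw [← h, sub_mul, mul_sub, trace_sub, trace_sub, Matrix.mul_assoc, Matrix.mul_assoc,
      Matrix.trace_mul_comm A (D₁ * Aᵀ), Matrix.mul_assoc]
  have h2 : (D₁ᵀ * (A * Aᵀ - Aᵀ * A)).trace = (D₁ * (A * Aᵀ - Aᵀ * A)).trace := by
    rw [← trace_transpose, transpose_mul, transpose_transpose, Matrix.trace_mul_comm]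
    simp [transpose_sub, transpose_mul]
  have h3 : (((1/2 : ℝ) • (D₁ + D₁ᵀ)) * (A * Aᵀ - Aᵀ * A)).trace
      = (D₁ * (A * Aᵀ - Aᵀ * A)).trace := by
    rw [smul_mul_assoc, add_mul, trace_smul, trace_add, h2, smul_eq_mul]; ring
  have h4 : (A * Aᵀ - Aᵀ * A).trace = 0 := by
    rw [trace_sub, Matrix.trace_mul_comm, sub_self]
  have h5 : ((A + Aᵀ)^2 * (A * Aᵀ - Aᵀ * A)).trace = 0 := by
    have hK : A * Aᵀ - Aᵀ * A = A * (A + Aᵀ) - (A + Aᵀ) * A := by noncomm_ring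
    rw [hK]
    generalize A + Aᵀ = S
    have h : (S^2 * (A * S)).trace = (S^2 * (S * A)).trace := by
      rw [← Matrix.mul_assoc, Matrix.trace_mul_comm]
      congr 1
      noncomm_ring
    rw [mul_sub, trace_sub, h, sub_self]
  rw [h1, ← h3, hS, Q1]
  generalize A * Aᵀ - Aᵀ * A = K at *
  simp only [sub_mul, add_mul, smul_mul_assoc, one_mul, trace_sub, trace_add, trace_smul, h4, h5,
    smul_eq_mul, pow_two K]
  ring
end

section
/- Let a, b, c ∈ ℂ, not all zero, and let A := [[0,a,b],[0,0,c],[0,0,0]] ∈ M₃(ℂ). Write A* for the conjugate transpose of A and [X,Y] := XY − YX. Then tr(AA*)·[A, [A,A*] − (A+A*)²] = −tr([A,A*]²)·A if and only if a = 0 or c = 0. -/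
open Matrix

/-- For a strictly upper triangular `A = [[0,a,b],[0,0,c],[0,0,0]] ∈ M₃(ℂ)`, not zero,
the soliton equation `tr(AA*)·[A,[A,A*]−(A+A*)²] = −tr([A,A*]²)·A` holds iff
`a = 0` or `c = 0`. -/
theorem stmt18 (a b c : ℂ) (h : ¬(a = 0 ∧ b = 0 ∧ c = 0))
    (A : Matrix (Fin 3) (Fin 3) ℂ) (hA : A = !![0, a, b; 0, 0, c; 0, 0, 0]) :
    ((A * Aᴴ).trace •
        (A * ((A * Aᴴ - Aᴴ * A) - (A + Aᴴ)^2)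
          - ((A * Aᴴ - Aᴴ * A) - (A + Aᴴ)^2) * A)
      = (-((A * Aᴴ - Aᴴ * A)^2).trace) • A) ↔ (a = 0 ∨ c = 0) := by
  have hH : Aᴴ = !![0, 0, 0; (starRingEnd ℂ) a, 0, 0; (starRingEnd ℂ) b, (starRingEnd ℂ) c, 0] := by
    subst hA
    ext i j
    fin_cases i <;> fin_cases j <;> simp [Matrix.conjTranspose_apply]
  rw [hH]
  subst hA
  constructor
  · intro H
    by_contra hne
    push Not at hne
    obtain ⟨ha, hc⟩ := hne
    have H21 := congrFun (congrFun H 2) 1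
    simp [Matrix.mul_apply, Matrix.trace, Fin.sum_univ_three, pow_two ] at H21
    have hT : a * (starRingEnd ℂ) a + b * (starRingEnd ℂ) b + c * (starRingEnd ℂ) c ≠ 0 := by
      rw [Complex.mul_conj, Complex.mul_conj, Complex.mul_conj]
      have h1 := Complex.normSq_pos.mpr ha
      have h2 := Complex.normSq_nonneg b
      have h3 := Complex.normSq_nonneg c
      norm_cast
      positivity
    have ha' : (starRingEnd ℂ) a ≠ 0 := by simpa using ha
    have hc' : (starRingEnd ℂ) c ≠ 0 := by simpa using hc
    have key : (a * (starRingEnd ℂ) a + b * (starRingEnd ℂ) b + c * (starRingEnd ℂ) c) *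
        ((starRingEnd ℂ) a * (starRingEnd ℂ) c * a) = 0 := by
      grind
    simp [hT, ha, ha', hc'] at key
  · rintro (rfl | rfl) <;> ext i j <;> fin_cases i <;> fin_cases j <;>
      simp [Matrix.mul_apply, Matrix.trace, Fin.sum_univ_three, pow_two] <;>
      ring
end
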